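/- (Davis–Kahan/Weyl step in the representation-accuracy proof.) Let W ∈ ℝ^{d×d} be symmetric positive semidefinite of rank r, with r-th largest eigenvalue σ_r(W) > 0, and let B ∈ ℝ^{d×r} be an orthonormal basis of the column space of W, with orthonormal complement B_⊥. Let c ≥ 0, let Ŵ ∈ ℝ^{d×d} be symmetric, and set Δ = ‖Ŵ − (W + cI_d)‖_F. If Δ < σ_r(W) and B̂ ∈ ℝ^{d×r} is an orthonormal matrix whose columns are eigenvectors of Ŵ associated with its r largest eigenvalues, then ‖B̂ᵀB_⊥‖_F ≤ Δ/(σ_r(W) − Δ). -/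

import Mathlib

open Matrix

/-- The Frobenius norm of a real matrix. -/
noncomputable def frobNorm {ι κ : Type*} [Fintype ι] [Fintype κ]
    (A : Matrix ι κ ℝ) : ℝ :=
  Real.sqrt (∑ i, ∑ j, A i j ^ 2)

theorem aux_bessel {ι κ : Type*} [Fintype ι] [Fintype κ] [DecidableEq κ]
    (A : Matrix ι κ ℝ) (hA : Aᵀ * A = 1) (m : ι → ℝ) :
    (Aᵀ *ᵥ m) ⬝ᵥ (Aᵀ *ᵥ m) ≤ m ⬝ᵥ m := by
  set b := Aᵀ *ᵥ m with hb
  have h0 : 0 ≤ (m - A *ᵥ b) ⬝ᵥ (m - A *ᵥ b) := by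
    simp only [dotProduct]
    exact Finset.sum_nonneg fun i _ => mul_self_nonneg _
  have h1 : m ⬝ᵥ (A *ᵥ b) = b ⬝ᵥ b := by
    rw [Matrix.dotProduct_mulVec, ← Matrix.mulVec_transpose]
  have h2 : (A *ᵥ b) ⬝ᵥ (A *ᵥ b) = b ⬝ᵥ b := by
    rw [Matrix.dotProduct_mulVec, ← Matrix.mulVec_transpose, Matrix.mulVec_mulVec, hA,
      Matrix.one_mulVec]
  have h3 : (A *ᵥ b) ⬝ᵥ m = b ⬝ᵥ b := by rw [dotProduct_comm, h1]
  rw [sub_dotProduct, dotProduct_sub, dotProduct_sub, h1, h2, h3] at h0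
  linarith

theorem aux_left {ι κ l : Type*} [Fintype ι] [Fintype κ] [Fintype l] [DecidableEq κ]
    (A : Matrix ι κ ℝ) (hA : Aᵀ * A = 1) (M : Matrix ι l ℝ) :
    ∑ i, ∑ j, (Aᵀ * M) i j ^ 2 ≤ ∑ i, ∑ j, M i j ^ 2 := by
  rw [Finset.sum_comm, Finset.sum_comm (f := fun i j => M i j ^ 2)]
  refine Finset.sum_le_sum fun j _ => ?_
  have := aux_bessel A hA (fun i => M i j)
  simpa [dotProduct, Matrix.mulVec, Matrix.mul_apply, sq] using this

theorem aux_both {ι κ l : Type*} [Fintype ι] [Fintype κ] [Fintype l] [DecidableEq κ]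
    [DecidableEq l]
    (A : Matrix ι κ ℝ) (hA : Aᵀ * A = 1) (C : Matrix ι l ℝ) (hC : Cᵀ * C = 1)
    (M : Matrix ι ι ℝ) :
    ∑ i, ∑ j, (Aᵀ * (M * C)) i j ^ 2 ≤ ∑ i, ∑ j, M i j ^ 2 := by
  refine (aux_left A hA _).trans ?_
  have := aux_left C hC Mᵀ
  rw [← Matrix.transpose_mul, Finset.sum_comm, Finset.sum_comm (f := fun i j => Mᵀ i j ^ 2)] at this
  simpa using this

theorem aux_quad {ι : Type*} [Fintype ι] (E : Matrix ι ι ℝ) (v : ι → ℝ) :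
    |v ⬝ᵥ (E *ᵥ v)| ≤ frobNorm E * (v ⬝ᵥ v) := by
  have hv : 0 ≤ v ⬝ᵥ v := by
    simp only [dotProduct]
    exact Finset.sum_nonneg fun i _ => mul_self_nonneg _
  have hE : 0 ≤ ∑ i, ∑ j, E i j ^ 2 := by positivity
  refine abs_le_of_sq_le_sq ?_ (mul_nonneg (Real.sqrt_nonneg _) hv)
  rw [mul_pow, frobNorm, Real.sq_sqrt hE]
  have := Finset.sum_mul_sq_le_sq_mul_sq (Finset.univ : Finset (ι × ι))
    (fun p => E p.1 p.2) (fun p => v p.1 * v p.2)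
  simp only [Fintype.sum_prod_type] at this
  convert this using 2
  · simp only [dotProduct, Matrix.mulVec, Finset.mul_sum]
    refine Finset.sum_congr rfl fun i _ => Finset.sum_congr rfl fun j _ => by ring
  · rw [sq]
    simp only [dotProduct, Finset.sum_mul_sum]
    refine Finset.sum_congr rfl fun i _ => Finset.sum_congr rfl fun j _ => by ring

theorem aux_diag {ι : Type*} [Fintype ι] [DecidableEq ι] (U : Matrix ι ι ℝ) (μ : ι → ℝ)
    (v : ι → ℝ) :
    v ⬝ᵥ ((U * Matrix.diagonal μ * Uᵀ) *ᵥ v) = ∑ i, μ i * (Uᵀ *ᵥ v) i ^ 2 := by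
  rw [← Matrix.mulVec_mulVec, ← Matrix.mulVec_mulVec, Matrix.dotProduct_mulVec,
    ← Matrix.mulVec_transpose]
  simp only [dotProduct, Matrix.mulVec_diagonal]
  exact Finset.sum_congr rfl fun i _ => by ring

theorem aux_norm {ι : Type*} [Fintype ι] [DecidableEq ι] (U : Matrix ι ι ℝ)
    (hU : Uᵀ * U = 1) (v : ι → ℝ) :
    v ⬝ᵥ v = ∑ i, (Uᵀ *ᵥ v) i ^ 2 := by
  have h := aux_diag U 1 v
  have h1 : Matrix.diagonal (1 : ι → ℝ) = 1 := Matrix.diagonal_one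
  rw [h1, Matrix.mul_one, mul_eq_one_comm.mp hU, Matrix.one_mulVec] at h
  simpa using h

theorem aux_weyl {d : ℕ} (k : Fin d) (U V : Matrix (Fin d) (Fin d) ℝ) (μ ν : Fin d → ℝ)
    (hU : Uᵀ * U = 1) (hV : Vᵀ * V = 1) (hμ : Antitone μ) (hν : Antitone ν) (c : ℝ) :
    μ k + c - frobNorm (V * Matrix.diagonal ν * Vᵀ - (U * Matrix.diagonal μ * Uᵀ + c • 1))
      ≤ ν k := by
  set E := V * Matrix.diagonal ν * Vᵀ - (U * Matrix.diagonal μ * Uᵀ + c • 1) with hE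
  let N : Matrix (Fin d) (Fin d) ℝ := fun i =>
    if i < k then (Vᵀ) i else if i = k then 0 else (Uᵀ) i
  have hdet : N.det = 0 := Matrix.det_eq_zero_of_row_eq_zero k (fun j => by simp [N])
  obtain ⟨v, hv0, hv⟩ := Matrix.exists_mulVec_eq_zero_iff.mpr hdet
  have hq : ∀ i, i < k → (Vᵀ *ᵥ v) i = 0 := fun i hi => by
    have := congrFun hv i
    simpa [N, Matrix.mulVec, hi] using this
  have hp : ∀ i, k < i → (Uᵀ *ᵥ v) i = 0 := fun i hi => by
    have := congrFun hv i
    simpa [N, Matrix.mulVec, hi.not_gt, hi.ne'] using this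
  have hpos : 0 < v ⬝ᵥ v := by
    refine lt_of_le_of_ne ?_ (fun h => hv0 (dotProduct_self_eq_zero.mp h.symm))
    simp only [dotProduct]
    exact Finset.sum_nonneg fun i _ => mul_self_nonneg _
  have h1 : μ k * (v ⬝ᵥ v) ≤ v ⬝ᵥ ((U * Matrix.diagonal μ * Uᵀ) *ᵥ v) := by
    rw [aux_diag, aux_norm U hU, Finset.mul_sum]
    refine Finset.sum_le_sum fun i _ => ?_
    rcases le_or_gt i k with h | h
    · exact mul_le_mul_of_nonneg_right (hμ h) (sq_nonneg _)
    · simp [hp i h]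
  have h2 : v ⬝ᵥ ((V * Matrix.diagonal ν * Vᵀ) *ᵥ v) ≤ ν k * (v ⬝ᵥ v) := by
    rw [aux_diag, aux_norm V hV, Finset.mul_sum]
    refine Finset.sum_le_sum fun i _ => ?_
    rcases le_or_gt k i with h | h
    · exact mul_le_mul_of_nonneg_right (hν h) (sq_nonneg _)
    · simp [hq i h]
  have h3 := (abs_le.mp (aux_quad E v)).1
  have h4 : v ⬝ᵥ (E *ᵥ v) = v ⬝ᵥ ((V * Matrix.diagonal ν * Vᵀ) *ᵥ v)
      - v ⬝ᵥ ((U * Matrix.diagonal μ * Uᵀ) *ᵥ v) - c * (v ⬝ᵥ v) := by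
    rw [hE, Matrix.sub_mulVec, Matrix.add_mulVec, Matrix.smul_mulVec, Matrix.one_mulVec,
      dotProduct_sub, dotProduct_add, dotProduct_smul, smul_eq_mul]
    ring
  refine le_of_mul_le_mul_right ?_ hpos
  nlinarith

/-- (Davis–Kahan/Weyl step.) Let `W` be symmetric PSD of rank `r` with
`r`-th largest eigenvalue `σ_r(W) > 0`, `B` an orthonormal basis of the column space of `W`
(the first `r` columns of an orthonormal eigenbasis `U` of `W` with decreasing eigenvalues
`μ`, where `μ i = 0` for `i ≥ r`), `B_⊥` an orthonormal complement. Let `Ŵ` be symmetric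
with orthonormal eigenbasis `Û` and decreasing eigenvalues `μ̂`, and let `B̂` consist of
eigenvectors of `Ŵ` for its `r` largest eigenvalues (the first `r` columns of `Û`).
If `Δ = ‖Ŵ − (W + cI)‖_F < σ_r(W)`, then `‖B̂ᵀB_⊥‖_F ≤ Δ/(σ_r(W) − Δ)`. -/
theorem stmt14 {d r : ℕ} (hr : 0 < r) (hrd : r ≤ d)
    (W What : Matrix (Fin d) (Fin d) ℝ)
    (hWpsd : W.PosSemidef) (hWhatsymm : What.IsSymm)
    (U Uhat : Matrix (Fin d) (Fin d) ℝ) (μ μhat : Fin d → ℝ)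
    (hU : Uᵀ * U = 1) (hUhat : Uhatᵀ * Uhat = 1)
    (hWdec : W = U * Matrix.diagonal μ * Uᵀ)
    (hWhatdec : What = Uhat * Matrix.diagonal μhat * Uhatᵀ)
    (hμanti : Antitone μ) (hμhatanti : Antitone μhat)
    (hμzero : ∀ i : Fin d, r ≤ (i : ℕ) → μ i = 0)
    (σr : ℝ) (hσr : σr = μ ⟨r - 1, by omega⟩) (hσrpos : 0 < σr)
    (B Bhat : Matrix (Fin d) (Fin r) ℝ)
    (hB : ∀ (i : Fin d) (j : Fin r), B i j = U i (Fin.castLE hrd j))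
    (hBhat : ∀ (i : Fin d) (j : Fin r), Bhat i j = Uhat i (Fin.castLE hrd j))
    (Bperp : Matrix (Fin d) (Fin (d - r)) ℝ)
    (hBperp : Bperpᵀ * Bperp = 1) (hBBperp : Bᵀ * Bperp = 0)
    (c : ℝ) (hc : 0 ≤ c)
    (Δ : ℝ) (hΔ : Δ = frobNorm (What - (W + c • 1)))
    (hΔlt : Δ < σr) :
    frobNorm (Bhatᵀ * Bperp) ≤ Δ / (σr - Δ) := by
  have hWB : W * Bperp = 0 := by
    have : Matrix.diagonal μ * (Uᵀ * Bperp) = 0 := by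
      ext i j
      rw [Matrix.diagonal_mul]
      by_cases h : r ≤ (i : ℕ)
      · simp [hμzero i h]
      · have h' := congrFun (congrFun hBBperp ⟨i, by omega⟩) j
        simp only [Matrix.mul_apply, Matrix.transpose_apply, hB] at h'
        have h'' : (Uᵀ * Bperp) i j = 0 := by
          simpa [Matrix.mul_apply] using h'
        simp [h'']
    rw [hWdec, Matrix.mul_assoc, Matrix.mul_assoc, this, Matrix.mul_zero]
  have hBh : Bhatᵀ * Bhat = 1 := by
    ext i j
    have := congrFun (congrFun hUhat (Fin.castLE hrd i)) (Fin.castLE hrd j)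
    simp only [Matrix.mul_apply, Matrix.transpose_apply, Matrix.one_apply] at this
    simp only [Matrix.mul_apply, Matrix.transpose_apply, hBhat, this, Matrix.one_apply]
    simp
  have hBW : ∀ i j, (Bhatᵀ * What) i j = μhat (Fin.castLE hrd i) * Bhat j i := by
    intro i j
    have h : Uhatᵀ * What = Matrix.diagonal μhat * Uhatᵀ := by
      rw [hWhatdec, Matrix.mul_assoc, ← Matrix.mul_assoc, hUhat, Matrix.one_mul]
    have := congrFun (congrFun h (Fin.castLE hrd i)) j
    rw [Matrix.diagonal_mul] at this
    simpa [Matrix.mul_apply, hBhat] using this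
  have hent : ∀ i j, (Bhatᵀ * ((What - (W + c • (1 : Matrix (Fin d) (Fin d) ℝ))) * Bperp)) i j
      = (μhat (Fin.castLE hrd i) - c) * (Bhatᵀ * Bperp) i j := by
    intro i j
    have e : Bhatᵀ * ((What - (W + c • (1 : Matrix (Fin d) (Fin d) ℝ))) * Bperp)
        = Bhatᵀ * What * Bperp - c • (Bhatᵀ * Bperp) := by
      rw [Matrix.sub_mul, Matrix.add_mul, hWB, Matrix.mul_sub, zero_add, Matrix.smul_mul,
        Matrix.one_mul, Matrix.mul_smul, Matrix.mul_assoc]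
    rw [e, Matrix.sub_apply, Matrix.smul_apply, smul_eq_mul, sub_mul]
    congr 1
    rw [Matrix.mul_apply, Matrix.mul_apply, Finset.mul_sum]
    refine Finset.sum_congr rfl fun k _ => ?_
    rw [hBW, Matrix.transpose_apply, mul_assoc]
  have hw := aux_weyl ⟨r - 1, by omega⟩ U Uhat μ μhat hU hUhat hμanti hμhatanti c
  rw [← hWdec, ← hWhatdec, ← hΔ, ← hσr] at hw
  have hgap : ∀ i : Fin r, σr - Δ ≤ μhat (Fin.castLE hrd i) - c := by
    intro i
    have : μhat ⟨r - 1, by omega⟩ ≤ μhat (Fin.castLE hrd i) := by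
      apply hμhatanti
      rw [Fin.le_def]
      simp only [Fin.val_castLE]
      omega
    linarith
  have hpos : 0 < σr - Δ := by linarith
  rw [le_div_iff₀ hpos]
  have hb := aux_both Bhat hBh Bperp hBperp (What - (W + c • 1))
  have hΔ0 : 0 ≤ Δ := by rw [hΔ]; exact Real.sqrt_nonneg _
  refine abs_le_of_sq_le_sq' ?_ hΔ0 |>.2
  have hΔ2 : Δ ^ 2 = ∑ i, ∑ j, (What - (W + c • (1 : Matrix (Fin d) (Fin d) ℝ))) i j ^ 2 := by
    rw [hΔ, frobNorm, Real.sq_sqrt (by positivity)]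
  rw [mul_pow, frobNorm, Real.sq_sqrt (by positivity), hΔ2]
  refine le_trans ?_ hb
  rw [Finset.sum_mul]
  refine Finset.sum_le_sum fun i _ => ?_
  rw [Finset.sum_mul]
  refine Finset.sum_le_sum fun j _ => ?_
  rw [hent, mul_pow, mul_comm]
  exact mul_le_mul_of_nonneg_right (pow_le_pow_left₀ hpos.le (hgap i) 2) (sq_nonneg _)
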